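/- arXiv:1507.00965 — 2 statements merged into one kernel-verified Lean document; each statement's English description precedes it below -/
import Mathlib

section
/- Let ν_X and ν_Y be independent k-dimensional random vectors each converging in distribution to N_k(0, C) with C positive definite, and let α(m,n), β(m,n) be positive reals with α² + β² = (n+m)/m + (n+m)/n along a sequence where m/(m+n) → θ ∈ (0,1). Then the normalized quadratic form (α² + β²)^{-1} (αν_X − βν_Y)ᵀ C⁻¹ (αν_X − βν_Y) converges in distribution to a chi-square distribution with k degrees of freedom. -/
open MeasureTheory ProbabilityTheory Matrix Filter Topology
open scoped BoundedContinuousFunction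

/-- The law of a standard Gaussian vector in `ℝ^k`. -/
noncomputable def stdGaussianPi (k : ℕ) : Measure (Fin k → ℝ) :=
  Measure.pi fun _ : Fin k => gaussianReal 0 1

/-- The chi-square distribution with `k` degrees of freedom. -/
noncomputable def chiSq (k : ℕ) : Measure ℝ :=
  Measure.map (fun x : Fin k → ℝ => ∑ i, (x i) ^ 2) (stdGaussianPi k)

/-- Convergence in distribution of a sequence of random elements to a limit law,
tested against bounded continuous functions. -/
def TendstoInDistribution {Ω E : Type*} [MeasurableSpace Ω] [MeasurableSpace E] [TopologicalSpace E]
    (P : Measure Ω) (V : ℕ → Ω → E) (μ : Measure E) : Prop :=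
  ∀ φ : E →ᵇ ℝ, Tendsto (fun j => ∫ ω, φ (V j ω) ∂P) atTop (𝓝 (∫ x, φ x ∂μ))

instance isProbabilityMeasure_stdGaussianPi (k : ℕ) :
    IsProbabilityMeasure (stdGaussianPi k) := by
  unfold stdGaussianPi; infer_instance

lemma tendstoInDistribution_iff_tendsto_probabilityMeasure {Ω E : Type*} [MeasurableSpace Ω]
    [MeasurableSpace E] [TopologicalSpace E] [OpensMeasurableSpace E] {P : Measure Ω}
    {V : ℕ → Ω → E} (hV : ∀ j, Measurable (V j)) {μ : Measure E}
    {ρ : ℕ → ProbabilityMeasure E} {ρ₀ : ProbabilityMeasure E}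
    (hρ : ∀ j, (ρ j : Measure E) = P.map (V j)) (hρ₀ : (ρ₀ : Measure E) = μ) :
    _root_.TendstoInDistribution P V μ ↔ Tendsto ρ atTop (𝓝 ρ₀) := by
  rw [ProbabilityMeasure.tendsto_iff_forall_integral_tendsto]
  refine forall_congr' fun φ => ?_
  have h (j : ℕ) : ∫ x, φ x ∂(P.map (V j)) = ∫ ω, φ (V j ω) ∂P :=
    integral_map (hV j).aemeasurable φ.continuous.measurable.aestronglyMeasurable
  simp only [hρ, hρ₀, h]

lemma gaussianReal_prod_map_linearCombination {a b : ℝ} (hab : a ^ 2 + b ^ 2 = 1) :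
    ((gaussianReal 0 1).prod (gaussianReal 0 1)).map (fun p : ℝ × ℝ => a * p.1 + b * p.2) =
      gaussianReal 0 1 := by
  have hprod : ((gaussianReal 0 1).prod (gaussianReal 0 1)).map
      (Prod.map (fun x : ℝ => a * x) (fun x : ℝ => b * x)) =
      ((gaussianReal 0 1).map (a * ·)).prod ((gaussianReal 0 1).map (b * ·)) :=
    (Measure.map_prod_map _ _ (by fun_prop) (by fun_prop)).symm
  have hcomp : (fun p : ℝ × ℝ => a * p.1 + b * p.2) =
      (fun p : ℝ × ℝ => p.1 + p.2) ∘ Prod.map (fun x : ℝ => a * x) (fun x : ℝ => b * x) := rfl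
  rw [hcomp, ← Measure.map_map (by fun_prop) (by fun_prop), hprod,
    gaussianReal_map_const_mul, gaussianReal_map_const_mul]
  refine (gaussianReal_conv_gaussianReal).trans ?_
  congr 1
  · simp
  · ext
    simpa using hab

/-- A rotation combining two independent standard Gaussian vectors is standard Gaussian. -/
lemma stdGaussianPi_prod_map_linearCombination (k : ℕ) {a b : ℝ} (hab : a ^ 2 + b ^ 2 = 1) :
    ((stdGaussianPi k).prod (stdGaussianPi k)).map
      (fun p : (Fin k → ℝ) × (Fin k → ℝ) => fun i => a * p.1 i + b * p.2 i) =
      stdGaussianPi k := by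
  have h := measurePreserving_arrowProdEquivProdArrow ℝ ℝ (Fin k)
    (fun _ => gaussianReal 0 1) (fun _ => gaussianReal 0 1)
  have hpi := measurePreserving_pi
    (fun _ : Fin k => (gaussianReal 0 1).prod (gaussianReal 0 1)) (fun _ => gaussianReal 0 1)
    (f := fun _ (p : ℝ × ℝ) => a * p.1 + b * p.2)
    (fun _ => ⟨by fun_prop, gaussianReal_prod_map_linearCombination hab⟩)
  unfold stdGaussianPi
  rw [← h.map_eq, Measure.map_map (by fun_prop) h.measurable]
  exact hpi.map_eq

lemma mulVec_dotProduct_inv_mulVec {k : ℕ} {A C : Matrix (Fin k) (Fin k) ℝ} (hAC : A * Aᵀ = C)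
    (hC : C.PosDef) (w : Fin k → ℝ) :
    (A *ᵥ w) ⬝ᵥ (C⁻¹ *ᵥ (A *ᵥ w)) = ∑ i, w i ^ 2 := by
  have hdet : IsUnit A.det := by
    have h := hC.det_pos.ne'
    rw [← hAC, det_mul] at h
    exact (left_ne_zero_of_mul h).isUnit
  have hone : Aᵀ * (C⁻¹ * A) = 1 := by
    have hdet' : IsUnit Aᵀ.det := by rwa [det_transpose]
    rw [← hAC, Matrix.mul_inv_rev, Matrix.mul_assoc, nonsing_inv_mul _ hdet, Matrix.mul_one,
      mul_nonsing_inv _ hdet']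
  rw [← vecMul_transpose A w, ← dotProduct_mulVec, vecMul_transpose, mulVec_mulVec, mulVec_mulVec,
    Matrix.mul_assoc, hone, one_mulVec]
  simp [dotProduct, sq]

/-- The quadratic form `s (a x - b y)ᵀ M (a x - b y)`, as a function of `(s, a, b)` and `(x, y)`. -/
def combinedQuadraticForm {k : ℕ} (M : Matrix (Fin k) (Fin k) ℝ)
    (p : (ℝ × ℝ × ℝ) × ((Fin k → ℝ) × (Fin k → ℝ))) : ℝ :=
  p.1.1 * ((fun i => p.1.2.1 * p.2.1 i - p.1.2.2 * p.2.2 i) ⬝ᵥ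
    M *ᵥ (fun i => p.1.2.1 * p.2.1 i - p.1.2.2 * p.2.2 i))

lemma continuous_combinedQuadraticForm {k : ℕ} (M : Matrix (Fin k) (Fin k) ℝ) :
    Continuous (combinedQuadraticForm M) := by
  unfold combinedQuadraticForm
  simp only [dotProduct, mulVec]
  fun_prop

lemma map_combinedQuadraticForm_gaussian {k : ℕ} {A C : Matrix (Fin k) (Fin k) ℝ}
    (hAC : A * Aᵀ = C) (hC : C.PosDef) {s a b : ℝ} (hs : 0 ≤ s) (h : s * (a ^ 2 + b ^ 2) = 1) :
    ((stdGaussianPi k).map (fun x => A *ᵥ x) |>.prod ((stdGaussianPi k).map (fun x => A *ᵥ x))).map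
      (fun q => combinedQuadraticForm C⁻¹ ((s, a, b), q)) = chiSq k := by
  have hA : Measurable (fun x : Fin k → ℝ => A *ᵥ x) :=
    (continuous_const.matrix_mulVec continuous_id).measurable
  have hQ : Measurable (fun q => combinedQuadraticForm C⁻¹ ((s, a, b), q)) :=
    ((continuous_combinedQuadraticForm C⁻¹).comp (by fun_prop)).measurable
  have hab : (√s * a) ^ 2 + (-(√s * b)) ^ 2 = 1 := by
    rw [neg_sq, mul_pow, mul_pow, Real.sq_sqrt hs, ← mul_add, h]
  rw [Measure.map_prod_map _ _ hA hA, Measure.map_map hQ (hA.prodMap hA), chiSq]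
  conv_rhs => rw [← stdGaussianPi_prod_map_linearCombination k hab]
  rw [Measure.map_map (by fun_prop) (by fun_prop)]
  congr 1
  funext ⟨u, v⟩
  have hw : (fun i => a * (A *ᵥ u) i - b * (A *ᵥ v) i) = A *ᵥ (a • u - b • v) := by
    rw [mulVec_sub, mulVec_smul, mulVec_smul]
    rfl
  simp only [Function.comp_apply, Prod.map_apply, combinedQuadraticForm, hw,
    mulVec_dotProduct_inv_mulVec hAC hC, Finset.mul_sum]
  refine Finset.sum_congr rfl fun i _ => ?_
  calc s * (a • u - b • v) i ^ 2 = √s ^ 2 * (a * u i - b * v i) ^ 2 := by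
        rw [Real.sq_sqrt hs]; rfl
    _ = _ := by ring

/-- Independent sequences converging in distribution, together with convergent deterministic
parameters, may be substituted into a jointly continuous function. -/
lemma TendstoInDistribution.continuous_comp_of_indepFun {Ω E F T G : Type*} [MeasurableSpace Ω]
    {P : Measure Ω} [IsProbabilityMeasure P]
    [TopologicalSpace E] [SecondCountableTopology E] [TopologicalSpace.PseudoMetrizableSpace E]
    [MeasurableSpace E] [BorelSpace E]
    [TopologicalSpace F] [SecondCountableTopology F] [TopologicalSpace.PseudoMetrizableSpace F]
    [MeasurableSpace F] [BorelSpace F]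
    [TopologicalSpace T] [SecondCountableTopology T] [TopologicalSpace.PseudoMetrizableSpace T]
    [MeasurableSpace T] [BorelSpace T]
    [TopologicalSpace G] [MeasurableSpace G] [BorelSpace G]
    {X : ℕ → Ω → E} {Y : ℕ → Ω → F} (hmX : ∀ j, Measurable (X j)) (hmY : ∀ j, Measurable (Y j))
    {μ : Measure E} {ν : Measure F} [hμ : IsProbabilityMeasure μ] [hν : IsProbabilityMeasure ν]
    (hX : _root_.TendstoInDistribution P X μ) (hY : _root_.TendstoInDistribution P Y ν)
    (hindep : ∀ j, IndepFun (X j) (Y j) P) {t : ℕ → T} {t₀ : T} (ht : Tendsto t atTop (𝓝 t₀))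
    {g : T × (E × F) → G} (hg : Continuous g) :
    _root_.TendstoInDistribution P (fun j ω => g (t j, X j ω, Y j ω))
      ((μ.prod ν).map fun q => g (t₀, q)) := by
  have hg' (c : T) : Measurable fun q => g (c, q) := (hg.comp (by fun_prop)).measurable
  have hm (j : ℕ) : Measurable fun ω => g (t j, X j ω, Y j ω) :=
    (hg' (t j)).comp ((hmX j).prodMk (hmY j))
  let ρX (j : ℕ) : ProbabilityMeasure E :=
    ⟨P.map (X j), Measure.isProbabilityMeasure_map (hmX j).aemeasurable⟩
  let ρY (j : ℕ) : ProbabilityMeasure F :=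
    ⟨P.map (Y j), Measure.isProbabilityMeasure_map (hmY j).aemeasurable⟩
  have hX' : Tendsto ρX atTop (𝓝 ⟨μ, hμ⟩) :=
    (tendstoInDistribution_iff_tendsto_probabilityMeasure hmX (fun _ => rfl) rfl).1 hX
  have hY' : Tendsto ρY atTop (𝓝 ⟨ν, hν⟩) :=
    (tendstoInDistribution_iff_tendsto_probabilityMeasure hmY (fun _ => rfl) rfl).1 hY
  have hXY := (ProbabilityMeasure.continuous_prod.tendsto _).comp (hX'.prodMk_nhds hY')
  have hdirac := (continuous_diracProba.tendsto t₀).comp ht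
  have hall := (ProbabilityMeasure.continuous_prod.tendsto _).comp (hdirac.prodMk_nhds hXY)
  have hmap := ProbabilityMeasure.tendsto_map_of_tendsto_of_continuous _ _ hall hg
  have hgm (c : T) (ρ : Measure (E × F)) [SFinite ρ] :
      ((Measure.dirac c).prod ρ).map g = ρ.map fun q => g (c, q) := by
    rw [Measure.dirac_prod, Measure.map_map hg.measurable (by fun_prop)]
    rfl
  refine (tendstoInDistribution_iff_tendsto_probabilityMeasure hm (fun j => ?_) ?_).2 hmap
  · change ((Measure.dirac (t j)).prod ((P.map (X j)).prod (P.map (Y j)))).map g = _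
    rw [hgm, ← (indepFun_iff_map_prod_eq_prod_map_map (hmX j).aemeasurable
      (hmY j).aemeasurable).1 (hindep j), Measure.map_map (hg' _) ((hmX j).prodMk (hmY j))]
    rfl
  · exact hgm t₀ (μ.prod ν)

/-- let `ν_X(j)` and `ν_Y(j)` be independent `k`-dimensional random
vectors, each converging in distribution to `N_k(0, C)` (`C = A Aᵀ` positive
definite), along sample sizes `m j, n j → ∞` with `m/(m+n) → θ ∈ (0,1)`; with
`α = √((n+m)/m)`, `β = √((n+m)/n)` (so `α² + β² = (n+m)/m + (n+m)/n`), the quadratic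
form `(α² + β²)⁻¹ (α ν_X − β ν_Y)ᵀ C⁻¹ (α ν_X − β ν_Y)` converges in distribution to
the chi-square distribution with `k` degrees of freedom. -/
theorem stmt10 {k : ℕ} {Ω : Type*} [MeasurableSpace Ω] (P : Measure Ω)
    [IsProbabilityMeasure P] (νX νY : ℕ → Ω → Fin k → ℝ)
    (hmX : ∀ j, Measurable (νX j)) (hmY : ∀ j, Measurable (νY j))
    (m n : ℕ → ℕ) (hm : Tendsto m atTop atTop) (hn : Tendsto n atTop atTop)
    (θ : ℝ) (hθ : θ ∈ Set.Ioo (0 : ℝ) 1)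
    (hratio : Tendsto (fun j => (m j : ℝ) / (m j + n j)) atTop (𝓝 θ))
    (A C : Matrix (Fin k) (Fin k) ℝ) (hAC : A * Aᵀ = C) (hC : C.PosDef)
    (hXlim : TendstoInDistribution P νX (Measure.map (fun x => A.mulVec x) (stdGaussianPi k)))
    (hYlim : TendstoInDistribution P νY (Measure.map (fun x => A.mulVec x) (stdGaussianPi k)))
    (hindep : ∀ j, IndepFun (νX j) (νY j) P) :
    TendstoInDistribution P
      (fun j ω =>
        let α : ℝ := Real.sqrt ((n j + m j : ℝ) / m j)
        let β : ℝ := Real.sqrt ((n j + m j : ℝ) / n j)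
        let η : Fin k → ℝ := fun i => α * νX j ω i - β * νY j ω i
        (α ^ 2 + β ^ 2)⁻¹ * (η ⬝ᵥ C⁻¹.mulVec η))
      (chiSq k) := by
  have hθ₀ : 0 < θ := hθ.1
  have hθ₁ : 0 < 1 - θ := sub_pos.2 hθ.2
  have hα : Tendsto (fun j => √((n j + m j : ℝ) / m j)) atTop (𝓝 √θ⁻¹) := by
    refine (Real.continuous_sqrt.tendsto _).comp ((hratio.inv₀ hθ₀.ne').congr fun j => ?_)
    rw [inv_div, add_comm]
  have hβ : Tendsto (fun j => √((n j + m j : ℝ) / n j)) atTop (𝓝 √(1 - θ)⁻¹) := by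
    refine (Real.continuous_sqrt.tendsto _).comp
      (((hratio.const_sub 1).inv₀ hθ₁.ne').congr' ?_)
    filter_upwards [hm.eventually_gt_atTop 0] with j hj
    have hmj : (0 : ℝ) < m j := Nat.cast_pos.2 hj
    have hsum : (m j + n j : ℝ) ≠ 0 := by positivity
    rw [one_sub_div hsum, add_sub_cancel_left, inv_div, add_comm]
  have hpos : 0 < √θ⁻¹ ^ 2 + √(1 - θ)⁻¹ ^ 2 := by positivity
  have hs := ((hα.pow 2).add (hβ.pow 2)).inv₀ hpos.ne'
  have hA : Measurable (fun x : Fin k → ℝ => A *ᵥ x) :=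
    (continuous_const.matrix_mulVec continuous_id).measurable
  have : IsProbabilityMeasure ((stdGaussianPi k).map fun x => A *ᵥ x) :=
    Measure.isProbabilityMeasure_map hA.aemeasurable
  rw [← map_combinedQuadraticForm_gaussian hAC hC (inv_nonneg.2 hpos.le)
    (inv_mul_cancel₀ hpos.ne')]
  exact TendstoInDistribution.continuous_comp_of_indepFun hmX hmY hXlim hYlim hindep
    (hs.prodMk_nhds (hα.prodMk_nhds hβ)) (continuous_combinedQuadraticForm C⁻¹)
end

section
/- If 𝒢 is a class of functions on an interval J each of total variation bounded by D > 0 and uniformly bounded by a constant, then the metric entropy of 𝒢 in L²(λ) satisfies log N₂(ε, 𝒢, λ) ≤ K/ε for some constant K depending only on D, J and the uniform bound, and consequently 𝒢 satisfies Pollard's entropy condition ∫₀¹ √(log N₂(ε, 𝒢, λ)) dε < ∞. -/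
open MeasureTheory
open scoped ENNReal

/-- `covN p ε 𝒢 Q` : the `ε`-covering number of the class `𝒢` in `L^p(Q)`. -/
noncomputable def covN {α : Type*} [MeasurableSpace α] (p : ℝ≥0∞) (ε : ℝ)
    (𝒢 : Set (α → ℝ)) (Q : Measure α) : ℝ≥0∞ :=
  sInf ((fun s : Finset (α → ℝ) => (s.card : ℝ≥0∞)) ''
    {s | ∀ f ∈ 𝒢, ∃ h ∈ s, eLpNorm (f - h) p Q ≤ ENNReal.ofReal ε})

/-- Pollard's entropy condition for a covering-number function `N : ℝ → ℝ≥0∞`. -/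
def PollardCondition (N : ℝ → ℝ≥0∞) : Prop :=
  (∀ ε ∈ Set.Ioo (0 : ℝ) 1, N ε < ⊤) ∧
    IntegrableOn (fun ε => Real.sqrt (Real.log (N ε).toReal)) (Set.Ioo 0 1) volume

/-- The `j`-th point of the uniform grid dividing `[a, b]` into `m` cells. -/
noncomputable def gridPoint (a b : ℝ) (m j : ℕ) : ℝ := a + j * ((b - a) / m)

/-- The index of the cell of the uniform grid with `m` cells on `[a, b)` containing `x`. -/
noncomputable def gridIndex (a b : ℝ) (m : ℕ) (x : ℝ) : ℕ := ⌊(x - a) / ((b - a) / m)⌋₊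

/-- The step function taking on every cell of the grid the value of `g` at its left endpoint. -/
noncomputable def gridStep (a b : ℝ) (m : ℕ) (g : ℝ → ℝ) (x : ℝ) : ℝ :=
  g (gridPoint a b m (gridIndex a b m x))

/-- The total variation of `g` on the `j`-th closed cell of the grid. -/
noncomputable def cellVariation (a b : ℝ) (m : ℕ) (g : ℝ → ℝ) (j : ℕ) : ℝ :=
  (eVariationOn g (Set.Icc (gridPoint a b m j) (gridPoint a b m (j + 1)))).toReal

section Grid

variable {a b : ℝ} {m : ℕ}

lemma gridPoint_zero : gridPoint a b m 0 = a := by simp [gridPoint]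

lemma gridPoint_self (hm : 0 < m) : gridPoint a b m m = b := by
  have : (m : ℝ) ≠ 0 := by positivity
  unfold gridPoint
  field_simp
  ring

lemma monotone_gridPoint (hab : a < b) : Monotone (gridPoint a b m) := by
  intro i j hij
  have : 0 ≤ (b - a) / m := div_nonneg (by linarith) (by positivity)
  unfold gridPoint
  gcongr

lemma gridPoint_mem_Icc (hab : a < b) (hm : 0 < m) {j : ℕ} (hj : j ≤ m) :
    gridPoint a b m j ∈ Set.Icc a b := by
  constructor
  · simpa [gridPoint_zero] using monotone_gridPoint (m := m) hab (Nat.zero_le j)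
  · simpa [gridPoint_self hm] using monotone_gridPoint (m := m) hab hj

lemma gridPoint_two_mul (m j : ℕ) : gridPoint a b (2 * m) (2 * j) = gridPoint a b m j := by
  rcases Nat.eq_zero_or_pos m with rfl | hm
  · simp [gridPoint]
  · have : (m : ℝ) ≠ 0 := by positivity
    unfold gridPoint
    push_cast
    field_simp

lemma gridIndex_two_mul_div_two (m : ℕ) (x : ℝ) :
    gridIndex a b (2 * m) x / 2 = gridIndex a b m x := by
  unfold gridIndex
  rw [← Nat.floor_div_ofNat]
  congr 1
  push_cast
  rw [div_div_eq_mul_div, div_div_eq_mul_div]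
  ring

lemma mem_cell (hab : a < b) (hm : 0 < m) {x : ℝ} (hx : a ≤ x) :
    x ∈ Set.Ico (gridPoint a b m (gridIndex a b m x)) (gridPoint a b m (gridIndex a b m x + 1)) := by
  have hc : 0 < (b - a) / m := div_pos (by linarith) (by positivity)
  have h1 := Nat.floor_le (div_nonneg (sub_nonneg.2 hx) hc.le)
  have h2 := Nat.lt_floor_add_one ((x - a) / ((b - a) / m))
  rw [le_div_iff₀ hc] at h1
  rw [div_lt_iff₀ hc] at h2
  unfold gridPoint gridIndex
  push_cast
  constructor <;> linarith

lemma gridIndex_lt (hab : a < b) (hm : 0 < m) {x : ℝ} (hx : x ∈ Set.Ico a b) :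
    gridIndex a b m x < m := by
  by_contra! h
  have h1 := monotone_gridPoint (m := m) hab h
  rw [gridPoint_self hm] at h1
  linarith [(mem_cell hab hm hx.1).1, hx.2]

lemma measurable_gridIndex : Measurable (gridIndex a b m) := by
  unfold gridIndex
  exact Nat.measurable_floor.comp (by fun_prop)

lemma measurable_gridStep (g : ℝ → ℝ) : Measurable (gridStep a b m g) :=
  (measurable_from_nat (f := fun j => g (gridPoint a b m j))).comp measurable_gridIndex

/-- A function dominated by constants on the cells of a grid has its `L²` norm controlled by the
Euclidean norm of these constants. -/
lemma eLpNorm_two_le_of_cell_bound (hab : a < b) (hm : 0 < m) {f : ℝ → ℝ} {e : ℕ → ℝ}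
    (hf : ∀ x ∈ Set.Ico a b, |f x| ≤ e (gridIndex a b m x)) :
    eLpNorm f 2 (volume.restrict (Set.Icc a b)) ≤
      ENNReal.ofReal √((b - a) / m * ∑ j ∈ Finset.range m, e j ^ 2) := by
  have hc : 0 < (b - a) / m := div_pos (by linarith) (by positivity)
  have hS : ∀ j, 0 ≤ (b - a) / m * e j ^ 2 := fun j => by positivity
  rw [← Measure.restrict_congr_set Ico_ae_eq_Icc,
    eLpNorm_eq_lintegral_rpow_enorm_toReal two_ne_zero ENNReal.ofNat_ne_top, Real.sqrt_eq_rpow,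
    ← ENNReal.ofReal_rpow_of_nonneg (by positivity) (by norm_num), ENNReal.toReal_ofNat]
  refine ENNReal.rpow_le_rpow ?_ (by norm_num)
  let s : Fin m → Set ℝ := fun j => Set.Ico a b ∩ {x | gridIndex a b m x = j}
  have hs : Set.Ico a b ⊆ ⋃ j, s j := fun x hx =>
    Set.mem_iUnion.2 ⟨⟨_, gridIndex_lt hab hm hx⟩, hx, rfl⟩
  have hcell : ∀ j : Fin m, ∫⁻ x in s j, ‖f x‖ₑ ^ (2 : ℝ) ≤
      ENNReal.ofReal ((b - a) / m * e j ^ 2) := by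
    intro j
    have hms : MeasurableSet (s j) :=
      measurableSet_Ico.inter (measurable_gridIndex (measurableSet_singleton _))
    have hvol : volume (s j) ≤ ENNReal.ofReal ((b - a) / m) := by
      refine (measure_mono (t := Set.Ico (gridPoint a b m j) (gridPoint a b m (j + 1))) ?_).trans ?_
      · rintro x ⟨hx, hxj⟩
        have := mem_cell hab hm hx.1
        rwa [show gridIndex a b m x = j from hxj] at this
      · rw [Real.volume_Ico]
        apply le_of_eq
        congr 1
        unfold gridPoint
        push_cast
        ring
    calc ∫⁻ x in s j, ‖f x‖ₑ ^ (2 : ℝ) ≤ ∫⁻ x in s j, ENNReal.ofReal (e j ^ 2) := by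
          refine setLIntegral_mono measurable_const fun x hx => ?_
          rw [Real.enorm_eq_ofReal_abs, ENNReal.ofReal_rpow_of_nonneg (abs_nonneg _) (by norm_num)]
          refine ENNReal.ofReal_le_ofReal ?_
          have := hf x hx.1
          rw [show gridIndex a b m x = j from hx.2] at this
          rw [Real.rpow_two]
          exact pow_le_pow_left₀ (abs_nonneg _) this 2
      _ = ENNReal.ofReal (e j ^ 2) * volume (s j) := setLIntegral_const _ _
      _ ≤ ENNReal.ofReal (e j ^ 2) * ENNReal.ofReal ((b - a) / m) := by gcongr
      _ = _ := by rw [← ENNReal.ofReal_mul (by positivity), mul_comm]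
  calc ∫⁻ x in Set.Ico a b, ‖f x‖ₑ ^ (2 : ℝ) ≤ ∫⁻ x in ⋃ j, s j, ‖f x‖ₑ ^ (2 : ℝ) :=
        lintegral_mono_set hs
    _ ≤ ∑' j, ∫⁻ x in s j, ‖f x‖ₑ ^ (2 : ℝ) := lintegral_iUnion_le _ _
    _ = ∑ j, ∫⁻ x in s j, ‖f x‖ₑ ^ (2 : ℝ) := tsum_fintype _
    _ ≤ ∑ j : Fin m, ENNReal.ofReal ((b - a) / m * e j ^ 2) := Finset.sum_le_sum fun j _ => hcell j
    _ = ENNReal.ofReal ((b - a) / m * ∑ j ∈ Finset.range m, e j ^ 2) := by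
        rw [Finset.mul_sum, ← Fin.sum_univ_eq_sum_range (fun j => (b - a) / m * e j ^ 2),
          ENNReal.ofReal_sum_of_nonneg fun j _ => hS _]

variable {D : ℝ} {g : ℝ → ℝ}

lemma sum_eVariationOn_cell (hab : a < b) (hm : 0 < m) :
    ∑ j ∈ Finset.range m, eVariationOn g (Set.Icc (gridPoint a b m j) (gridPoint a b m (j + 1))) =
      eVariationOn g (Set.Icc a b) := by
  rw [eVariationOn.sum' g (monotone_gridPoint hab), gridPoint_zero, gridPoint_self hm]

lemma eVariationOn_cell_ne_top (hab : a < b) (hm : 0 < m)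
    (hg : eVariationOn g (Set.Icc a b) ≠ ⊤) {j : ℕ} (hj : j < m) :
    eVariationOn g (Set.Icc (gridPoint a b m j) (gridPoint a b m (j + 1))) ≠ ⊤ :=
  ne_top_of_le_ne_top hg <| eVariationOn.mono g <|
    Set.Icc_subset_Icc (gridPoint_mem_Icc hab hm hj.le).1 (gridPoint_mem_Icc hab hm hj).2

lemma cellVariation_nonneg (j : ℕ) : 0 ≤ cellVariation a b m g j := ENNReal.toReal_nonneg

lemma sum_cellVariation_le (hab : a < b) (hm : 0 < m) (hD : 0 ≤ D)
    (hg : eVariationOn g (Set.Icc a b) ≤ ENNReal.ofReal D) :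
    ∑ j ∈ Finset.range m, cellVariation a b m g j ≤ D := by
  have hfin := ne_top_of_le_ne_top ENNReal.ofReal_ne_top hg
  unfold cellVariation
  rw [← ENNReal.toReal_sum fun j hj =>
    eVariationOn_cell_ne_top hab hm hfin (Finset.mem_range.1 hj), sum_eVariationOn_cell hab hm]
  exact ENNReal.toReal_le_of_le_ofReal hD hg

lemma abs_sub_le_cellVariation (hab : a < b) (hm : 0 < m)
    (hg : eVariationOn g (Set.Icc a b) ≠ ⊤) {j : ℕ} (hj : j < m) {x y : ℝ}
    (hx : x ∈ Set.Icc (gridPoint a b m j) (gridPoint a b m (j + 1)))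
    (hy : y ∈ Set.Icc (gridPoint a b m j) (gridPoint a b m (j + 1))) :
    |g x - g y| ≤ cellVariation a b m g j := by
  rw [← Real.dist_eq]
  exact BoundedVariationOn.dist_le (eVariationOn_cell_ne_top hab hm hg hj) hx hy

/-- Functions of bounded variation are well approximated by step functions on fine grids. -/
lemma eLpNorm_sub_gridStep_le (hab : a < b) (hm : 0 < m) (hD : 0 ≤ D)
    (hg : eVariationOn g (Set.Icc a b) ≤ ENNReal.ofReal D) :
    eLpNorm (g - gridStep a b m g) 2 (volume.restrict (Set.Icc a b)) ≤
      ENNReal.ofReal √((b - a) / m * D ^ 2) := by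
  have hfin := ne_top_of_le_ne_top ENNReal.ofReal_ne_top hg
  have hc : 0 < (b - a) / m := div_pos (by linarith) (by positivity)
  refine (eLpNorm_two_le_of_cell_bound hab hm (e := cellVariation a b m g) fun x hx => ?_).trans ?_
  · have h := mem_cell hab hm hx.1
    exact abs_sub_le_cellVariation hab hm hfin (gridIndex_lt hab hm hx) ⟨h.1, h.2.le⟩
      ⟨le_rfl, h.1.trans h.2.le⟩
  · refine ENNReal.ofReal_le_ofReal (Real.sqrt_le_sqrt ?_)
    gcongr
    calc ∑ j ∈ Finset.range m, cellVariation a b m g j ^ 2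
        ≤ (∑ j ∈ Finset.range m, cellVariation a b m g j) ^ 2 :=
          Finset.sum_sq_le_sq_sum_of_nonneg fun j _ => cellVariation_nonneg j
      _ ≤ D ^ 2 := by
          gcongr
          · exact Finset.sum_nonneg fun j _ => cellVariation_nonneg j
          · exact sum_cellVariation_le hab hm hD hg

end Grid

section Counting

lemma sum_pow_natAbs_le {q : ℝ} (hq : 0 ≤ q) (hq1 : q < 1) (s : Finset ℤ) :
    ∑ z ∈ s, q ^ z.natAbs ≤ (1 + q) / (1 - q) := by
  have h1 : HasSum (fun n : ℕ => q ^ (n : ℤ).natAbs) (1 - q)⁻¹ := by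
    simpa using hasSum_geometric_of_lt_one hq hq1
  have h2 : HasSum (fun n : ℕ => q ^ (-((n : ℤ) + 1)).natAbs) (q * (1 - q)⁻¹) := by
    have h3 : ∀ n : ℕ, q ^ (-((n : ℤ) + 1)).natAbs = q * q ^ n := fun n => by
      rw [show (-((n : ℤ) + 1)).natAbs = n + 1 by omega, pow_succ']
    simp_rw [h3]
    exact (hasSum_geometric_of_lt_one hq hq1).mul_left q
  have h := HasSum.of_nat_of_neg_add_one (f := fun z : ℤ => q ^ z.natAbs) h1 h2
  refine (sum_le_hasSum s (fun z _ => by positivity) h).trans_eq ?_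
  ring

/-- A Chernoff-type bound on the number of integer points in an `ℓ¹` ball. -/
lemma exists_finset_of_sum_abs_le (m : ℕ) (M : ℝ) {t : ℝ} (ht : 0 < t) :
    ∃ Z : Finset (Fin m → ℤ),
      (Z.card : ℝ) ≤ Real.exp (t * M) * ((1 + Real.exp (-t)) / (1 - Real.exp (-t))) ^ m ∧
      ∀ z : Fin m → ℤ, ∑ j, |(z j : ℝ)| ≤ M → z ∈ Z := by
  classical
  set q := Real.exp (-t) with hq
  have hq0 : 0 < q := Real.exp_pos _
  have hq1 : q < 1 := by rw [hq, Real.exp_lt_one_iff]; linarith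
  let P : Finset (Fin m → ℤ) := Fintype.piFinset fun _ => Finset.Icc (-⌊M⌋) ⌊M⌋
  refine ⟨P.filter fun z => ∑ j, |(z j : ℝ)| ≤ M, ?_, fun z hz => ?_⟩
  · calc ((P.filter fun z => ∑ j, |(z j : ℝ)| ≤ M).card : ℝ)
        = ∑ z ∈ P.filter fun z => ∑ j, |(z j : ℝ)| ≤ M, 1 := by simp
      _ ≤ ∑ z ∈ P.filter fun z => ∑ j, |(z j : ℝ)| ≤ M,
            Real.exp (t * M) * ∏ j, q ^ (z j).natAbs := by
          refine Finset.sum_le_sum fun z hz => ?_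
          have h1 : ∏ j, q ^ (z j).natAbs = Real.exp (-(t * ∑ j, |(z j : ℝ)|)) := by
            rw [Finset.mul_sum, ← Finset.sum_neg_distrib, Real.exp_sum]
            refine Finset.prod_congr rfl fun j _ => ?_
            rw [hq, ← Real.exp_nat_mul, Nat.cast_natAbs, Int.cast_abs]
            ring_nf
          rw [h1, ← Real.exp_add]
          apply Real.one_le_exp
          nlinarith [(Finset.mem_filter.1 hz).2]
      _ ≤ ∑ z ∈ P, Real.exp (t * M) * ∏ j, q ^ (z j).natAbs :=
          Finset.sum_le_sum_of_subset_of_nonneg (Finset.filter_subset _ _)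
            fun z _ _ => by positivity
      _ = Real.exp (t * M) * ∏ _j : Fin m, ∑ z ∈ Finset.Icc (-⌊M⌋) ⌊M⌋, q ^ z.natAbs := by
          rw [← Finset.mul_sum, Finset.prod_univ_sum]
      _ ≤ Real.exp (t * M) * ∏ _j : Fin m, ((1 + q) / (1 - q)) := by
          gcongr
          exact sum_pow_natAbs_le hq0.le hq1 _
      _ = _ := by rw [Finset.prod_const, Finset.card_univ, Fintype.card_fin]
  · refine Finset.mem_filter.2 ⟨Fintype.mem_piFinset.2 fun j => ?_, hz⟩
    have h1 : |(z j : ℝ)| ≤ M :=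
      (Finset.single_le_sum (f := fun j => |(z j : ℝ)|) (fun i _ => abs_nonneg _)
        (Finset.mem_univ j)).trans hz
    have h2 : |z j| ≤ ⌊M⌋ := Int.le_floor.2 (by exact_mod_cast h1)
    exact Finset.mem_Icc.2 (abs_le.1 h2)

/-- Rounding a real number towards zero. -/
lemma exists_int_abs_le_abs (x : ℝ) :
    ∃ z : ℤ, |(z : ℝ)| ≤ |x| ∧ |x - z| ≤ 1 ∧ |x - z| ≤ |x| := by
  rcases le_total 0 x with hx | hx
  · have h0 : (0 : ℝ) ≤ ⌊x⌋ := by exact_mod_cast Int.floor_nonneg.2 hx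
    have h1 := Int.floor_le x
    have h2 := Int.lt_floor_add_one x
    refine ⟨⌊x⌋, ?_⟩
    rw [abs_of_nonneg hx, abs_of_nonneg h0, abs_of_nonneg (by linarith)]
    exact ⟨h1, by linarith, by linarith⟩
  · have h0 : (⌈x⌉ : ℝ) ≤ 0 := by exact_mod_cast Int.ceil_nonpos.2 hx
    have h1 := Int.le_ceil x
    have h2 := Int.ceil_lt_add_one x
    refine ⟨⌈x⌉, ?_⟩
    rw [abs_of_nonpos hx, abs_of_nonpos h0, abs_of_nonpos (by linarith)]
    exact ⟨by linarith, by linarith, by linarith⟩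

end Counting

section Refinement

variable {a b : ℝ} {m : ℕ} {D : ℝ} {g : ℝ → ℝ}

/-- The step function that vanishes on the left half of each of the `m` cells and takes the value
`c j` on the right half of the `j`-th one. -/
noncomputable def rightHalfStep (a b : ℝ) (m : ℕ) (c : ℕ → ℝ) (x : ℝ) : ℝ :=
  if gridIndex a b (2 * m) x % 2 = 1 then c (gridIndex a b m x) else 0

lemma measurable_rightHalfStep (c : ℕ → ℝ) : Measurable (rightHalfStep a b m c) :=
  Measurable.ite
    (measurable_gridIndex ((Set.to_countable {n : ℕ | n % 2 = 1}).measurableSet))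
    ((measurable_from_nat (f := c)).comp measurable_gridIndex) measurable_const

/-- The increment of `g` over the left half of the `j`-th cell. -/
noncomputable def halfIncrement (a b : ℝ) (m : ℕ) (g : ℝ → ℝ) (j : ℕ) : ℝ :=
  g (gridPoint a b (2 * m) (2 * j + 1)) - g (gridPoint a b m j)

lemma gridStep_two_mul_sub (x : ℝ) :
    gridStep a b (2 * m) g x - gridStep a b m g x =
      rightHalfStep a b m (halfIncrement a b m g) x := by
  have h := gridIndex_two_mul_div_two (a := a) (b := b) m x
  unfold rightHalfStep gridStep halfIncrement
  split_ifs with hodd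
  · rw [show gridIndex a b (2 * m) x = 2 * gridIndex a b m x + 1 by omega]
  · rw [show gridIndex a b (2 * m) x = 2 * gridIndex a b m x by omega, gridPoint_two_mul, sub_self]

lemma abs_halfIncrement_le (hab : a < b) (hm : 0 < m)
    (hg : eVariationOn g (Set.Icc a b) ≠ ⊤) {j : ℕ} (hj : j < m) :
    |halfIncrement a b m g j| ≤ cellVariation a b m g j := by
  have hmono := monotone_gridPoint (m := 2 * m) hab
  have h1 := gridPoint_two_mul (a := a) (b := b) m j
  have h2 := gridPoint_two_mul (a := a) (b := b) m (j + 1)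
  refine abs_sub_le_cellVariation hab hm hg hj ⟨?_, ?_⟩ ⟨le_rfl, ?_⟩
  · rw [← h1]; exact hmono (by omega)
  · rw [← h2]; exact hmono (by omega)
  · exact monotone_gridPoint hab (by omega)

/-- A finite class approximating, for all `g` of variation at most `D`, the difference between
consecutive dyadic step approximations of `g`. -/
lemma exists_finset_refinement (hab : a < b) (hm : 0 < m) (hD : 0 ≤ D) {δ t : ℝ} (hδ : 0 < δ)
    (ht : 0 < t) :
    ∃ U : Finset (ℝ → ℝ),
      (U.card : ℝ) ≤ Real.exp (t * (D / δ)) * ((1 + Real.exp (-t)) / (1 - Real.exp (-t))) ^ m ∧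
      (∀ u ∈ U, Measurable u) ∧
      ∀ g : ℝ → ℝ, eVariationOn g (Set.Icc a b) ≤ ENNReal.ofReal D → ∃ u ∈ U,
        eLpNorm (gridStep a b (2 * m) g - gridStep a b m g - u) 2
          (volume.restrict (Set.Icc a b)) ≤
            ENNReal.ofReal √((b - a) * min (δ * D / m) (δ ^ 2)) := by
  classical
  obtain ⟨Z, hZcard, hZ⟩ := exists_finset_of_sum_abs_le m (D / δ) ht
  let c : (Fin m → ℤ) → ℕ → ℝ := fun z j => if h : j < m then δ * z ⟨j, h⟩ else 0
  refine ⟨Z.image fun z => rightHalfStep a b m (c z), ?_, ?_, fun g hg => ?_⟩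
  · exact (Nat.cast_le.2 Finset.card_image_le).trans hZcard
  · intro u hu
    obtain ⟨z, -, rfl⟩ := Finset.mem_image.1 hu
    exact measurable_rightHalfStep _
  have hfin := ne_top_of_le_ne_top ENNReal.ofReal_ne_top hg
  have hsum := sum_cellVariation_le hab hm hD hg
  choose r hr1 hr2 hr3 using fun j => exists_int_abs_le_abs (halfIncrement a b m g j / δ)
  have hr1' : ∀ j, δ * |(r j : ℝ)| ≤ |halfIncrement a b m g j| := fun j => by
    have := hr1 j
    rw [abs_div, abs_of_pos hδ, le_div_iff₀ hδ] at this
    linarith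
  have hdiff : ∀ j, |halfIncrement a b m g j - δ * r j| =
      δ * |halfIncrement a b m g j / δ - r j| := fun j => by
    rw [← abs_of_pos hδ, ← abs_mul, abs_of_pos hδ]
    congr 1
    field_simp
  have hr2' : ∀ j, |halfIncrement a b m g j - δ * r j| ≤ δ := fun j => by
    rw [hdiff]
    nlinarith [hr2 j]
  have hr3' : ∀ j, |halfIncrement a b m g j - δ * r j| ≤ |halfIncrement a b m g j| := fun j => by
    rw [hdiff]
    calc δ * |halfIncrement a b m g j / δ - r j| ≤ δ * |halfIncrement a b m g j / δ| := by
          exact mul_le_mul_of_nonneg_left (hr3 j) hδ.le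
      _ = |halfIncrement a b m g j| := by
          rw [abs_div, abs_of_pos hδ]
          field_simp
  have hsumInc : ∑ j ∈ Finset.range m, |halfIncrement a b m g j| ≤ D :=
    (Finset.sum_le_sum fun j hj =>
      abs_halfIncrement_le hab hm hfin (Finset.mem_range.1 hj)).trans hsum
  refine ⟨_, Finset.mem_image_of_mem _ (hZ (fun j => r j) ?_), ?_⟩
  · rw [le_div_iff₀ hδ, Fin.sum_univ_eq_sum_range (fun j => |(r j : ℝ)|), Finset.sum_mul]
    refine (Finset.sum_le_sum fun j _ => ?_).trans hsumInc
    rw [mul_comm]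
    exact hr1' j
  · refine (eLpNorm_two_le_of_cell_bound hab hm
      (e := fun j => |halfIncrement a b m g j - δ * r j|) fun x hx => ?_).trans ?_
    · rw [Pi.sub_apply, Pi.sub_apply, gridStep_two_mul_sub]
      unfold rightHalfStep
      split_ifs with hodd
      · simp [c, gridIndex_lt hab hm hx]
      · simp
    · have hm' : (0 : ℝ) < m := by exact_mod_cast hm
      have hba : 0 < b - a := sub_pos.2 hab
      refine ENNReal.ofReal_le_ofReal (Real.sqrt_le_sqrt ?_)
      rw [div_mul_eq_mul_div, mul_div_assoc]
      refine mul_le_mul_of_nonneg_left (le_min ?_ ?_) hba.le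
      · gcongr
        calc ∑ j ∈ Finset.range m, |halfIncrement a b m g j - δ * r j| ^ 2
            ≤ ∑ j ∈ Finset.range m, δ * |halfIncrement a b m g j| := by
              refine Finset.sum_le_sum fun j _ => ?_
              rw [sq]
              exact mul_le_mul (hr2' j) (hr3' j) (abs_nonneg _) hδ.le
          _ ≤ δ * D := by
              rw [← Finset.mul_sum]
              gcongr
      · rw [div_le_iff₀ hm']
        calc ∑ j ∈ Finset.range m, |halfIncrement a b m g j - δ * r j| ^ 2
            ≤ ∑ j ∈ Finset.range m, δ ^ 2 :=
              Finset.sum_le_sum fun j _ => pow_le_pow_left₀ (abs_nonneg _) (hr2' j) 2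
          _ = δ ^ 2 * m := by simp [mul_comm]

end Refinement

section Chaining

variable {a b : ℝ} {D B : ℝ}

/-- A finite class of constants approximating `g a` for all `g` bounded by `B`. -/
lemma exists_finset_const (hab : a < b) (hB : 0 ≤ B) {n : ℝ} (hn : 0 < n) :
    ∃ S : Finset (ℝ → ℝ), (S.card : ℝ) ≤ Real.exp (2 * B * n) ∧ (∀ h ∈ S, Measurable h) ∧
      ∀ g : ℝ → ℝ, |g a| ≤ B → ∃ h ∈ S,
        eLpNorm (gridStep a b 1 g - h) 2 (volume.restrict (Set.Icc a b)) ≤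
          ENNReal.ofReal (√(b - a) / n) := by
  classical
  have hBn : 0 ≤ B * n := mul_nonneg hB hn.le
  refine ⟨(Finset.Icc (-⌊B * n⌋) ⌊B * n⌋).image fun z : ℤ => fun _ : ℝ => (z : ℝ) / n,
    ?_, ?_, fun g hg => ?_⟩
  · refine (Nat.cast_le.2 Finset.card_image_le).trans ?_
    have h0 : 0 ≤ ⌊B * n⌋ := Int.floor_nonneg.2 hBn
    have h1 : ((⌊B * n⌋ + 1 - -⌊B * n⌋).toNat : ℝ) = ((⌊B * n⌋ + 1 - -⌊B * n⌋ : ℤ) : ℝ) := by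
      exact_mod_cast Int.toNat_of_nonneg (by omega)
    rw [Int.card_Icc, h1]
    push_cast
    linarith [Int.floor_le (B * n), Real.add_one_le_exp (2 * B * n)]
  · intro h hh
    obtain ⟨z, -, rfl⟩ := Finset.mem_image.1 hh
    exact measurable_const
  · obtain ⟨z, hz1, hz2, -⟩ := exists_int_abs_le_abs (g a * n)
    have hz : z ∈ Finset.Icc (-⌊B * n⌋) ⌊B * n⌋ := by
      refine Finset.mem_Icc.2 (abs_le.1 (Int.le_floor.2 ?_))
      push_cast
      rw [abs_mul, abs_of_pos hn] at hz1
      exact hz1.trans (by gcongr)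
    refine ⟨_, Finset.mem_image_of_mem _ hz, ?_⟩
    refine (eLpNorm_two_le_of_cell_bound hab one_pos (e := fun _ => 1 / n)
      fun x hx => ?_).trans_eq ?_
    · have h0 : gridIndex a b 1 x = 0 := by simpa using gridIndex_lt hab one_pos hx
      have h1 : g a - z / n = (g a * n - z) / n := by field_simp
      rw [Pi.sub_apply, gridStep, h0, gridPoint_zero, h1, abs_div, abs_of_pos hn]
      gcongr
    · have : (b - a) / (1 : ℕ) * ∑ _j ∈ Finset.range 1, (1 / n) ^ 2 = (b - a) / n ^ 2 := by
        simp [div_eq_mul_inv]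
      rw [this, Real.sqrt_div (by linarith), Real.sqrt_sq hn.le]

/-- Chaining along the dyadic step approximations. -/
lemma exists_finset_chain (hab : a < b) (hD : 0 ≤ D) (hB : 0 ≤ B) {n : ℝ} (hn : 0 < n)
    {w e : ℕ → ℝ} (he : ∀ k, 0 ≤ e k)
    (hstep : ∀ k, ∃ δ > 0, ∃ t > 0,
      Real.exp (t * (D / δ)) * ((1 + Real.exp (-t)) / (1 - Real.exp (-t))) ^ 2 ^ k ≤
          Real.exp (w k) ∧
        √((b - a) * min (δ * D / 2 ^ k) (δ ^ 2)) ≤ e k) (k : ℕ) :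
    ∃ S : Finset (ℝ → ℝ),
      (S.card : ℝ) ≤ Real.exp (2 * B * n + ∑ i ∈ Finset.range k, w i) ∧
      (∀ h ∈ S, Measurable h) ∧
      ∀ g : ℝ → ℝ, eVariationOn g (Set.Icc a b) ≤ ENNReal.ofReal D → |g a| ≤ B → ∃ h ∈ S,
        eLpNorm (gridStep a b (2 ^ k) g - h) 2 (volume.restrict (Set.Icc a b)) ≤
          ENNReal.ofReal (√(b - a) / n + ∑ i ∈ Finset.range k, e i) := by
  classical
  induction k with
  | zero =>
    obtain ⟨S, h1, h2, h3⟩ := exists_finset_const (b := b) hab hB hn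
    exact ⟨S, by simpa using h1, h2, fun g _ hg => by simpa using h3 g hg⟩
  | succ k ih =>
    obtain ⟨S, hS1, hS2, hS3⟩ := ih
    obtain ⟨δ, hδ, t, ht, hw, hek⟩ := hstep k
    obtain ⟨U, hU1, hU2, hU3⟩ :=
      exists_finset_refinement hab (pow_pos two_pos k) hD hδ ht
    refine ⟨(S ×ˢ U).image fun p => p.1 + p.2, ?_, ?_, fun g hg hga => ?_⟩
    · refine (Nat.cast_le.2 Finset.card_image_le).trans ?_
      rw [Finset.card_product, Nat.cast_mul, Finset.sum_range_succ, ← add_assoc, Real.exp_add]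
      exact mul_le_mul hS1 (hU1.trans hw) (by positivity) (Real.exp_nonneg _)
    · intro h hh
      obtain ⟨p, hp, rfl⟩ := Finset.mem_image.1 hh
      rw [Finset.mem_product] at hp
      exact (hS2 _ hp.1).add (hU2 _ hp.2)
    · obtain ⟨h, hh, hh'⟩ := hS3 g hg hga
      obtain ⟨u, hu, hu'⟩ := hU3 g hg
      refine ⟨h + u, Finset.mem_image.2 ⟨(h, u), Finset.mk_mem_product hh hu, rfl⟩, ?_⟩
      have hsplit : gridStep a b (2 ^ (k + 1)) g - (h + u) = (gridStep a b (2 ^ k) g - h) +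
          (gridStep a b (2 * 2 ^ k) g - gridStep a b (2 ^ k) g - u) := by
        rw [pow_succ']
        abel
      rw [hsplit, Finset.sum_range_succ, ← add_assoc, ENNReal.ofReal_add _ (he k)]
      · refine (eLpNorm_add_le ?_ ?_ one_le_two).trans (add_le_add hh' (hu'.trans ?_))
        · exact ((measurable_gridStep g).sub (hS2 h hh)).aestronglyMeasurable
        · exact (((measurable_gridStep g).sub (measurable_gridStep g)).sub
            (hU2 u hu)).aestronglyMeasurable
        · push_cast
          exact ENNReal.ofReal_le_ofReal hek
      · have := Finset.sum_nonneg fun i (_ : i ∈ Finset.range k) => he i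
        positivity

lemma sum_range_ite_le_tsum {φ ψ : ℕ → ℝ} (hφ0 : ∀ i, 0 ≤ φ i) (hψ0 : ∀ i, 0 ≤ ψ i)
    (hφ : Summable φ) (hψ : Summable ψ) (L I : ℕ) :
    ∑ k ∈ Finset.range (L + I), (if k < L then φ (L - 1 - k) else ψ (k - L)) ≤
      ∑' i, φ i + ∑' i, ψ i := by
  rw [Finset.sum_range_add]
  refine add_le_add ?_ ?_
  · rw [Finset.sum_congr rfl fun k hk => if_pos (Finset.mem_range.1 hk),
      Finset.sum_range_reflect φ L]
    exact hφ.sum_le_tsum _ fun i _ => hφ0 i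
  · simp only [Nat.not_lt.2 (Nat.le_add_right L _), if_false, Nat.add_sub_cancel_left]
    exact hψ.sum_le_tsum _ fun i _ => hψ0 i

/-- Parameters for the levels coarser than the target resolution `2 ^ (k + 1 + i)`. -/
lemma coarse_level_bound (hab : a < b) (k i : ℕ) :
    ∃ δ > 0, ∃ t > 0,
      Real.exp (t * (D / δ)) * ((1 + Real.exp (-t)) / (1 - Real.exp (-t))) ^ 2 ^ k ≤
          Real.exp (2 ^ (k + 1 + i) * ((1 / 2) ^ i * (D + 4 + 2 * i))) ∧
        √((b - a) * min (δ * D / 2 ^ k) (δ ^ 2)) ≤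
          √(b - a) / 2 ^ (k + 1 + i) * (1 / 2) ^ i := by
  have hba : 0 < b - a := sub_pos.2 hab
  have hhalf : (2 : ℝ) ^ i * (1 / 2) ^ i = 1 := by rw [← mul_pow]; norm_num
  have hquart : (1 / 4 : ℝ) ^ i = (1 / 2) ^ i * (1 / 2) ^ i := by rw [← mul_pow]; norm_num
  have hfour : (4 : ℝ) ^ i * (1 / 4) ^ i = 1 := by rw [← mul_pow]; norm_num
  set δ : ℝ := (1 / 2) ^ i / 2 ^ (k + 1 + i) with hδ
  have hδ0 : 0 < δ := by positivity
  set t : ℝ := (1 / 4) ^ i with ht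
  have ht0 : 0 < t := by positivity
  have ht1 : t ≤ 1 := pow_le_one₀ (by norm_num) (by norm_num)
  refine ⟨δ, hδ0, t, ht0, ?_, ?_⟩
  · have h1 : t * (D / δ) = 2 ^ (k + 1 + i) * ((1 / 2) ^ i * D) := by
      rw [hquart, hδ]
      field_simp
    have hq : Real.exp (-t) ≤ 1 - t / 2 := by
      rw [Real.exp_neg, inv_le_comm₀ (Real.exp_pos t) (by linarith),
        inv_le_iff_one_le_mul₀' (by linarith)]
      nlinarith [Real.add_one_le_exp t]
    have h2 : (1 + Real.exp (-t)) / (1 - Real.exp (-t)) ≤ 4 ^ (i + 1) := by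
      rw [div_le_iff₀ (by linarith)]
      have h3 : (4 : ℝ) ^ (i + 1) * (t / 2) = 2 := by
        rw [ht, pow_succ]
        linarith
      calc 1 + Real.exp (-t) ≤ 4 ^ (i + 1) * (t / 2) := by linarith
        _ ≤ _ := by gcongr; linarith
    have h4 : (4 : ℝ) ≤ Real.exp 2 := by
      rw [show (2 : ℝ) = 1 + 1 by norm_num, Real.exp_add]
      nlinarith [Real.add_one_le_exp 1]
    have h5 : ((1 + Real.exp (-t)) / (1 - Real.exp (-t))) ^ 2 ^ k ≤
        Real.exp (2 ^ k * ((i + 1) * 2)) := by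
      have h6 : 0 ≤ (1 + Real.exp (-t)) / (1 - Real.exp (-t)) :=
        div_nonneg (by positivity) (by linarith)
      calc ((1 + Real.exp (-t)) / (1 - Real.exp (-t))) ^ 2 ^ k
          ≤ (Real.exp 2 ^ (i + 1)) ^ 2 ^ k := by
            gcongr
            exact h2.trans (by gcongr)
        _ = _ := by
          rw [← Real.exp_nat_mul, ← Real.exp_nat_mul]
          push_cast
          rfl
    rw [h1]
    refine (mul_le_mul_of_nonneg_left h5 (Real.exp_nonneg _)).trans ?_
    rw [← Real.exp_add]
    refine Real.exp_le_exp.2 ?_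
    have h7 : (2 : ℝ) ^ (k + 1 + i) * ((1 / 2) ^ i * (D + 4 + 2 * i)) =
        2 ^ (k + 1 + i) * ((1 / 2) ^ i * D) + 2 ^ k * ((4 + 2 * i) * 2) := by
      rw [pow_add, pow_succ]
      linear_combination 2 ^ k * 2 * (4 + 2 * (i : ℝ)) * hhalf
    rw [h7]
    refine add_le_add le_rfl (mul_le_mul_of_nonneg_left ?_ (by positivity))
    linarith [(Nat.cast_nonneg i : (0 : ℝ) ≤ i)]
  · calc √((b - a) * min (δ * D / 2 ^ k) (δ ^ 2)) ≤ √((b - a) * δ ^ 2) := by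
          gcongr
          exact min_le_right _ _
      _ = √(b - a) * δ := by rw [Real.sqrt_mul hba.le, Real.sqrt_sq hδ0.le]
      _ = _ := by rw [hδ]; ring

/-- Parameters for the levels finer than the target resolution `2 ^ L`. -/
lemma fine_level_bound (hab : a < b) (hD : 0 ≤ D) (L i : ℕ) :
    ∃ δ > 0, ∃ t > 0,
      Real.exp (t * (D / δ)) * ((1 + Real.exp (-t)) / (1 - Real.exp (-t))) ^ 2 ^ (L + i) ≤
          Real.exp (2 ^ L * (D * (8 / 9) ^ i * (1 + 2 * i) + 2 * (1 / 2) ^ i)) ∧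
        √((b - a) * min (δ * D / 2 ^ (L + i)) (δ ^ 2)) ≤
          √((b - a) * D) / 2 ^ L * (3 / 4) ^ i := by
  have hba : 0 < b - a := sub_pos.2 hab
  have hlog : 0 < Real.log 2 := Real.log_pos one_lt_two
  have hlog1 : Real.log 2 ≤ 1 := by linarith [Real.log_le_sub_one_of_pos (two_pos (α := ℝ))]
  set δ : ℝ := (9 / 8) ^ i / 2 ^ L with hδ
  have hδ0 : 0 < δ := by positivity
  set t : ℝ := (1 + 2 * i) * Real.log 2 with ht
  refine ⟨δ, hδ0, t, by positivity, ?_, ?_⟩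
  · have h1 : t * (D / δ) ≤ 2 ^ L * (D * (8 / 9) ^ i * (1 + 2 * i)) := by
      have h2 : D / δ = 2 ^ L * (D * (8 / 9) ^ i) := by
        rw [hδ, show (8 / 9 : ℝ) = (9 / 8)⁻¹ by norm_num, inv_pow]
        field_simp
      calc t * (D / δ) ≤ (1 + 2 * i) * 1 * (D / δ) := by rw [ht]; gcongr
        _ = _ := by rw [h2]; ring
    have hq : Real.exp (-t) = 1 / 2 * (1 / 4) ^ i := by
      rw [Real.exp_neg, ht, show (1 + 2 * (i : ℝ)) * Real.log 2 =
        ((1 + 2 * i : ℕ) : ℝ) * Real.log 2 by push_cast; ring, Real.exp_nat_mul,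
        Real.exp_log two_pos, pow_add, pow_mul, mul_inv, ← inv_pow, ← inv_pow]
      norm_num
    have hq0 := Real.exp_pos (-t)
    have hq1 : Real.exp (-t) ≤ 1 / 2 := by
      rw [hq]
      linarith [pow_le_one₀ (n := i) (show (0 : ℝ) ≤ 1 / 4 by norm_num) (by norm_num)]
    have h3 : (1 + Real.exp (-t)) / (1 - Real.exp (-t)) ≤ Real.exp (4 * Real.exp (-t)) := by
      refine le_trans ?_ (Real.add_one_le_exp _)
      rw [div_le_iff₀ (by linarith)]
      nlinarith
    have h4 : ((1 + Real.exp (-t)) / (1 - Real.exp (-t))) ^ 2 ^ (L + i) ≤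
        Real.exp (2 ^ L * (2 * (1 / 2) ^ i)) := by
      have h6 : 0 ≤ (1 + Real.exp (-t)) / (1 - Real.exp (-t)) :=
        div_nonneg (by positivity) (by linarith)
      have h7 : (2 : ℝ) ^ i * (1 / 4) ^ i = (1 / 2) ^ i := by rw [← mul_pow]; norm_num
      refine (pow_le_pow_left₀ h6 h3 _).trans_eq ?_
      rw [← Real.exp_nat_mul, hq]
      congr 1
      push_cast
      rw [pow_add, ← h7]
      ring
    refine (mul_le_mul (Real.exp_le_exp.2 h1) h4 (pow_nonneg ?_ _) (Real.exp_nonneg _)).trans_eq ?_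
    · exact div_nonneg (by positivity) (by linarith)
    · rw [← Real.exp_add, ← mul_add]
  · have h1 : (b - a) * (δ * D / 2 ^ (L + i)) = (b - a) * D * ((3 / 4) ^ i / 2 ^ L) ^ 2 := by
      have h2 : ((9 / 8 : ℝ)) ^ i = ((3 / 4) ^ i) ^ 2 * 2 ^ i := by
        rw [← pow_mul, mul_comm i 2, pow_mul, ← mul_pow]
        norm_num
      rw [hδ, h2, pow_add]
      field_simp
    calc √((b - a) * min (δ * D / 2 ^ (L + i)) (δ ^ 2))
        ≤ √((b - a) * (δ * D / 2 ^ (L + i))) := by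
          gcongr
          exact min_le_left _ _
      _ = √((b - a) * D) * ((3 / 4) ^ i / 2 ^ L) := by
          rw [h1, Real.sqrt_mul (by positivity), Real.sqrt_sq (by positivity)]
      _ = _ := by ring

/-- Functions on `[a, b]` with variation at most `D` and bounded by `B` can be approximated in
`L²` up to `C / 2 ^ L` by a class of at most `exp (A * 2 ^ L)` functions. -/
theorem exists_finset_of_bounded_variation (hab : a < b) (hD : 0 < D) (hB : 0 < B) :
    ∃ A > 0, ∃ C ≥ 1, ∀ L : ℕ, ∃ S : Finset (ℝ → ℝ), (S.card : ℝ) ≤ Real.exp (A * 2 ^ L) ∧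
      ∀ g : ℝ → ℝ, eVariationOn g (Set.Icc a b) ≤ ENNReal.ofReal D → |g a| ≤ B → ∃ h ∈ S,
        eLpNorm (g - h) 2 (volume.restrict (Set.Icc a b)) ≤ ENNReal.ofReal (C / 2 ^ L) := by
  have hba : 0 < b - a := sub_pos.2 hab
  let φ : ℕ → ℝ := fun i => (1 / 2) ^ i * (D + 4 + 2 * i)
  let ψ : ℕ → ℝ := fun i => D * (8 / 9) ^ i * (1 + 2 * i) + 2 * (1 / 2) ^ i
  have hgeom : ∀ r : ℝ, 0 ≤ r → r < 1 → Summable fun i : ℕ => r ^ i := fun r h0 h1 =>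
    summable_geometric_of_lt_one h0 h1
  have harith : ∀ r : ℝ, 0 ≤ r → r < 1 → Summable fun i : ℕ => (i : ℝ) * r ^ i := fun r h0 h1 => by
    simpa using summable_pow_mul_geometric_of_norm_lt_one 1
      (show ‖r‖ < 1 by rwa [Real.norm_of_nonneg h0])
  have hφ0 : ∀ i, 0 ≤ φ i := fun i => by positivity
  have hψ0 : ∀ i, 0 ≤ ψ i := fun i => by positivity
  have hφ : Summable φ := by
    refine (((hgeom (1 / 2) (by norm_num) (by norm_num)).mul_left (D + 4)).add
      ((harith (1 / 2) (by norm_num) (by norm_num)).mul_left 2)).congr fun i => ?_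
    simp only [φ]
    ring
  have hψ : Summable ψ := by
    refine ((((hgeom (8 / 9) (by norm_num) (by norm_num)).mul_left D).add
      ((harith (8 / 9) (by norm_num) (by norm_num)).mul_left (2 * D))).add
      ((hgeom (1 / 2) (by norm_num) (by norm_num)).mul_left 2)).congr fun i => ?_
    simp only [ψ]
    ring
  have hT1 : 0 ≤ ∑' i, φ i := tsum_nonneg hφ0
  have hT2 : 0 ≤ ∑' i, ψ i := tsum_nonneg hψ0
  let α : ℕ → ℝ := fun i => √(b - a) * (1 / 2) ^ i
  let β : ℕ → ℝ := fun i => √((b - a) * D) * (3 / 4) ^ i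
  have hα0 : ∀ i, 0 ≤ α i := fun i => by positivity
  have hβ0 : ∀ i, 0 ≤ β i := fun i => by positivity
  have hα : Summable α := (hgeom (1 / 2) (by norm_num) (by norm_num)).mul_left _
  have hβ : Summable β := (hgeom (3 / 4) (by norm_num) (by norm_num)).mul_left _
  have hT3 : 0 ≤ ∑' i, α i := tsum_nonneg hα0
  have hT4 : 0 ≤ ∑' i, β i := tsum_nonneg hβ0
  refine ⟨2 * B + (∑' i, φ i + ∑' i, ψ i), by positivity,
    √(b - a) + (∑' i, α i + ∑' i, β i) + 1, by have := Real.sqrt_nonneg (b - a); linarith,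
    fun L => ?_⟩
  let w : ℕ → ℝ := fun k => 2 ^ L * if k < L then φ (L - 1 - k) else ψ (k - L)
  let e : ℕ → ℝ := fun k => (if k < L then α (L - 1 - k) else β (k - L)) / 2 ^ L
  have he : ∀ k, 0 ≤ e k := fun k => by
    simp only [e]
    split_ifs
    · exact div_nonneg (hα0 _) (by positivity)
    · exact div_nonneg (hβ0 _) (by positivity)
  have hstep : ∀ k, ∃ δ > 0, ∃ t > 0,
      Real.exp (t * (D / δ)) * ((1 + Real.exp (-t)) / (1 - Real.exp (-t))) ^ 2 ^ k ≤
          Real.exp (w k) ∧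
        √((b - a) * min (δ * D / 2 ^ k) (δ ^ 2)) ≤ e k := fun k => by
    by_cases hk : k < L
    · have hL : k + 1 + (L - 1 - k) = L := by omega
      obtain ⟨δ, hδ, t, ht, h1, h2⟩ := coarse_level_bound (D := D) hab k (L - 1 - k)
      rw [hL] at h1 h2
      refine ⟨δ, hδ, t, ht, ?_, ?_⟩
      · simpa only [w, φ, if_pos hk] using h1
      · simp only [e, α, if_pos hk]
        exact h2.trans_eq (by ring)
    · obtain ⟨i, rfl⟩ := Nat.exists_eq_add_of_le (Nat.not_lt.1 hk)
      obtain ⟨δ, hδ, t, ht, h1, h2⟩ := fine_level_bound hab hD.le L i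
      refine ⟨δ, hδ, t, ht, ?_, ?_⟩
      · simpa only [w, ψ, if_neg hk, Nat.add_sub_cancel_left] using h1
      · simp only [e, β, if_neg hk, Nat.add_sub_cancel_left]
        exact h2.trans_eq (by ring)
  obtain ⟨I, hI⟩ := pow_unbounded_of_one_lt ((b - a) * D ^ 2 * 2 ^ L) (one_lt_two (α := ℝ))
  obtain ⟨S, hS1, hS2, hS3⟩ := exists_finset_chain hab hD.le hB.le
    (n := 2 ^ L) (by positivity) he hstep (L + I)
  refine ⟨S, hS1.trans (Real.exp_le_exp.2 ?_), fun g hg hga => ?_⟩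
  · have := sum_range_ite_le_tsum hφ0 hψ0 hφ hψ L I
    rw [← Finset.mul_sum, add_mul, mul_comm (_ + _) ((2 : ℝ) ^ L)]
    gcongr
  · obtain ⟨h, hh, hh'⟩ := hS3 g hg hga
    refine ⟨h, hh, ?_⟩
    have hmeas : AEStronglyMeasurable g (volume.restrict (Set.Icc a b)) := by
      have hbv : BoundedVariationOn g (Set.Icc a b) :=
        ne_top_of_le_ne_top ENNReal.ofReal_ne_top hg
      obtain ⟨p, q, hp, hq, rfl⟩ := hbv.locallyBoundedVariationOn.exists_monotoneOn_sub_monotoneOn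
      exact ((aemeasurable_restrict_of_monotoneOn measurableSet_Icc hp).sub
        (aemeasurable_restrict_of_monotoneOn measurableSet_Icc hq)).aestronglyMeasurable
    have hsplit : g - h = (g - gridStep a b (2 ^ (L + I)) g) +
        (gridStep a b (2 ^ (L + I)) g - h) := by abel
    have hsum := sum_range_ite_le_tsum hα0 hβ0 hα hβ L I
    have hfine : √((b - a) / (2 ^ (L + I) : ℕ) * D ^ 2) ≤ 1 / 2 ^ L := by
      rw [Real.sqrt_le_left (by positivity)]
      push_cast
      rw [div_mul_eq_mul_div, div_pow, one_pow, div_le_div_iff₀ (by positivity) (by positivity),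
        pow_add]
      nlinarith [pow_pos (two_pos (α := ℝ)) L]
    have hsum0 : 0 ≤ √(b - a) / 2 ^ L + ∑ i ∈ Finset.range (L + I), e i :=
      add_nonneg (by positivity) (Finset.sum_nonneg fun i _ => he i)
    rw [hsplit]
    refine (eLpNorm_add_le (hmeas.sub (measurable_gridStep g).aestronglyMeasurable)
      ((measurable_gridStep g).sub (hS2 h hh)).aestronglyMeasurable one_le_two).trans ?_
    refine (add_le_add (eLpNorm_sub_gridStep_le hab (by positivity) hD.le hg) hh').trans ?_
    rw [← ENNReal.ofReal_add (Real.sqrt_nonneg _) hsum0]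
    refine ENNReal.ofReal_le_ofReal ?_
    have h1 : ∑ i ∈ Finset.range (L + I), e i ≤ (∑' i, α i + ∑' i, β i) / 2 ^ L := by
      rw [← Finset.sum_div]
      gcongr
    calc √((b - a) / (2 ^ (L + I) : ℕ) * D ^ 2) +
          (√(b - a) / 2 ^ L + ∑ i ∈ Finset.range (L + I), e i)
        ≤ 1 / 2 ^ L + (√(b - a) / 2 ^ L + (∑' i, α i + ∑' i, β i) / 2 ^ L) := by gcongr
      _ = _ := by ring

end Chaining

lemma covN_le_card {α : Type*} [MeasurableSpace α] {p : ℝ≥0∞} {ε : ℝ} {𝒢 : Set (α → ℝ)}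
    {Q : Measure α} {S : Finset (α → ℝ)}
    (hS : ∀ f ∈ 𝒢, ∃ h ∈ S, eLpNorm (f - h) p Q ≤ ENNReal.ofReal ε) :
    covN p ε 𝒢 Q ≤ S.card :=
  sInf_le ⟨S, hS, rfl⟩

lemma antitone_covN {α : Type*} [MeasurableSpace α] (p : ℝ≥0∞) (𝒢 : Set (α → ℝ))
    (Q : Measure α) : Antitone fun ε => covN p ε 𝒢 Q := by
  intro ε ε' hε
  refine sInf_le_sInf (Set.image_mono fun s hs f hf => ?_)
  obtain ⟨h, hh, hh'⟩ := hs f hf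
  exact ⟨h, hh, hh'.trans (ENNReal.ofReal_le_ofReal hε)⟩

/-- An antitone covering function with entropy of order `1 / ε` satisfies Pollard's condition. -/
lemma PollardCondition.of_le_exp_div {N : ℝ → ℝ≥0∞} (hN : Antitone N) {K : ℝ} (hK : 0 < K)
    (h : ∀ ε ∈ Set.Ioo (0 : ℝ) 1, N ε ≤ ENNReal.ofReal (Real.exp (K / ε))) :
    PollardCondition N := by
  refine ⟨fun ε hε => (h ε hε).trans_lt ENNReal.ofReal_lt_top, ?_⟩
  have hint : IntegrableOn (fun ε : ℝ => √K * ε ^ (-(1 / 2) : ℝ)) (Set.Ioo 0 1) :=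
    ((intervalIntegral.integrableOn_Ioo_rpow_iff one_pos).2 (by norm_num)).const_mul _
  refine Integrable.mono' hint ?_ ?_
  · exact (Real.continuous_sqrt.measurable.comp (Real.measurable_log.comp
      hN.measurable.ennreal_toReal)).aestronglyMeasurable
  · refine (ae_restrict_iff' measurableSet_Ioo).2 (Filter.Eventually.of_forall fun ε hε => ?_)
    rw [Real.norm_of_nonneg (Real.sqrt_nonneg _), Real.rpow_neg hε.1.le, ← Real.sqrt_eq_rpow,
      ← div_eq_mul_inv, ← Real.sqrt_div hK.le]
    refine Real.sqrt_le_sqrt ?_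
    have h1 : (N ε).toReal ≤ Real.exp (K / ε) :=
      ENNReal.toReal_le_of_le_ofReal (Real.exp_nonneg _) (h ε hε)
    rcases ENNReal.toReal_nonneg.eq_or_lt with h0 | h0
    · rw [← h0, Real.log_zero]
      exact div_nonneg hK.le hε.1.le
    · exact (Real.log_le_iff_le_exp h0).2 h1

/-- if every `g ∈ 𝒢` has total variation on `J = [a,b]` bounded by
`D > 0` and is uniformly bounded by `B`, then `log N₂(ε, 𝒢, λ) ≤ K/ε` on `(0,1)` for
some constant `K` (depending only on `D`, `J` and `B`), and consequently `𝒢`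
satisfies Pollard's entropy condition `∫₀¹ √(log N₂(ε, 𝒢, λ)) dε < ∞`. -/
theorem stmt13 (a b : ℝ) (hab : a < b) (𝒢 : Set (ℝ → ℝ)) (D B : ℝ) (hD : 0 < D)
    (hB : 0 < B)
    (hvar : ∀ g ∈ 𝒢, eVariationOn g (Set.Icc a b) ≤ ENNReal.ofReal D)
    (hbdd : ∀ g ∈ 𝒢, ∀ t ∈ Set.Icc a b, |g t| ≤ B) :
    (∃ K > 0, ∀ ε ∈ Set.Ioo (0 : ℝ) 1,
        covN 2 ε 𝒢 (volume.restrict (Set.Icc a b)) ≤ ENNReal.ofReal (Real.exp (K / ε))) ∧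
      PollardCondition (fun ε => covN 2 ε 𝒢 (volume.restrict (Set.Icc a b))) := by
  suffices hent : ∃ K > 0, ∀ ε ∈ Set.Ioo (0 : ℝ) 1,
      covN 2 ε 𝒢 (volume.restrict (Set.Icc a b)) ≤ ENNReal.ofReal (Real.exp (K / ε)) by
    refine ⟨hent, ?_⟩
    obtain ⟨K, hK, h⟩ := hent
    exact PollardCondition.of_le_exp_div (antitone_covN _ _ _) hK h
  obtain ⟨A, hA, C, hC, hS⟩ := exists_finset_of_bounded_variation hab hD hB
  have hC0 : 0 < C := by linarith
  refine ⟨2 * A * C, by positivity, fun ε hε => ?_⟩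
  have hε0 : 0 < ε := hε.1
  obtain ⟨n, hn1, hn2⟩ := exists_nat_pow_near
    (show 1 ≤ C / ε from (one_le_div hε0).2 (hε.2.le.trans hC)) (one_lt_two (α := ℝ))
  obtain ⟨S, hcard, happrox⟩ := hS (n + 1)
  have hSmem : ∀ g ∈ 𝒢, ∃ h ∈ S,
      eLpNorm (g - h) 2 (volume.restrict (Set.Icc a b)) ≤ ENNReal.ofReal ε := fun g hg => by
    obtain ⟨h, hh, hh'⟩ := happrox g (hvar g hg) (hbdd g hg a ⟨le_rfl, hab.le⟩)
    refine ⟨h, hh, hh'.trans (ENNReal.ofReal_le_ofReal ?_)⟩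
    rw [div_le_iff₀ (by positivity)]
    rw [div_lt_iff₀ hε0] at hn2
    linarith
  refine (covN_le_card hSmem).trans ?_
  rw [← ENNReal.ofReal_natCast]
  refine ENNReal.ofReal_le_ofReal (hcard.trans (Real.exp_le_exp.2 ?_))
  calc A * 2 ^ (n + 1) = 2 * A * 2 ^ n := by ring
    _ ≤ 2 * A * (C / ε) := by gcongr
    _ = 2 * A * C / ε := by ring
end
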